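/- arXiv:2209.01956 — 3 statements merged into one kernel-verified Lean document; each statement's English description precedes it below -/
import Mathlib

section
/- (Unbiasedness of the first orthogonal score at the truth, i = 0) Under the interactive model with both noise conditions, overlap, and D ∈ {0,1} a.s., the true causal parameter θ0^0 := E[g0(0, Z)] satisfies E[g0(0, Z) + (1 − D) · (Y − g0(0, Z)) / (1 − m0(Z))] = θ0^0, i.e., E[ψ1(W, θ0^0, ρ0)] = 0. -/
open MeasureTheory ProbabilityTheory

/-- A function whose conditional expectation given `m` vanishes is orthogonal to every
`m`-measurable function. -/
theorem integral_mul_eq_zero_of_condExp_eq_zero {Ω : Type*} {m mΩ : MeasurableSpace Ω}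
    {μ : Measure Ω} [IsFiniteMeasure μ] (hm : m ≤ mΩ) {f g : Ω → ℝ}
    (hf : StronglyMeasurable[m] f) (hfg : Integrable (f * g) μ) (hg : Integrable g μ)
    (h0 : μ[g | m] =ᵐ[μ] 0) : ∫ ω, f ω * g ω ∂μ = 0 := by
  have h : μ[f * g | m] =ᵐ[μ] 0 := by
    filter_upwards [condExp_mul_of_stronglyMeasurable_left hf hfg hg, h0] with ω h1 h2
    simp [h1, h2]
  calc ∫ ω, f ω * g ω ∂μ = ∫ ω, (μ[f * g | m]) ω ∂μ := (integral_condExp hm).symm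
    _ = 0 := by simp [integral_congr_ae h]

/-- Unbiasedness of the first orthogonal score at the truth, i = 0: Under the
interactive model with both noise conditions, overlap and `D ∈ {0,1}` a.s.,
`E[g0(0, Z) + (1 − D) · (Y − g0(0, Z)) / (1 − m0(Z))] = E[g0(0, Z)] = θ0^0`. -/
theorem stmt_9
    {Ω : Type*} [MeasurableSpace Ω] (P : Measure Ω) [IsProbabilityMeasure P]
    {E : Type*} [MeasurableSpace E]
    (Z : Ω → E) (hZ : Measurable Z)
    (D : Ω → ℝ) (hD : Measurable D) (hD01 : ∀ᵐ ω ∂P, D ω = 0 ∨ D ω = 1)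
    (Y : Ω → ℝ) (hY : Integrable Y P)
    (g0 : ℝ × E → ℝ) (hg0 : Measurable g0)
    (m0 : E → ℝ) (hm0 : Measurable m0)
    (hg0int : Integrable (fun ω => g0 (D ω, Z ω)) P)
    (hg0zint : Integrable (fun ω => g0 (0, Z ω)) P)
    (hm0int : Integrable (fun ω => m0 (Z ω)) P)
    (hxi : P[fun ω => Y ω - g0 (D ω, Z ω) |
        MeasurableSpace.comap (fun ω => (D ω, Z ω)) inferInstance] =ᵐ[P] 0)
    (hnu : P[fun ω => D ω - m0 (Z ω) | MeasurableSpace.comap Z inferInstance] =ᵐ[P] 0)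
    (ε : ℝ) (hε : ε ∈ Set.Ioo (0 : ℝ) (1 / 2))
    (hover : ∀ᵐ ω ∂P, ε ≤ m0 (Z ω) ∧ m0 (Z ω) ≤ 1 - ε) :
    ∫ ω, (g0 (0, Z ω) + (1 - D ω) * (Y ω - g0 (0, Z ω)) / (1 - m0 (Z ω))) ∂P =
      ∫ ω, g0 (0, Z ω) ∂P := by
  have hDZ : Measurable fun ω => (D ω, Z ω) := hD.prodMk hZ
  have hw : Measurable fun p : ℝ × E => (1 - p.1) / (1 - m0 p.2) := by fun_prop
  have hξ : Integrable (fun ω => Y ω - g0 (D ω, Z ω)) P := hY.sub hg0int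
  have hbound : ∀ᵐ ω ∂P, ‖(1 - D ω) / (1 - m0 (Z ω))‖ ≤ 1 / ε := by
    filter_upwards [hD01, hover] with ω hd ho
    have hpos : 0 < ε := hε.1
    have hle : ε ≤ 1 - m0 (Z ω) := by linarith [ho.2]
    rw [Real.norm_eq_abs, abs_div, abs_of_pos (hpos.trans_le hle)]
    refine div_le_div₀ zero_le_one ?_ hpos hle
    rcases hd with hd | hd <;> simp [hd]
  have hint : Integrable
      (fun ω => (1 - D ω) / (1 - m0 (Z ω)) * (Y ω - g0 (D ω, Z ω))) P :=
    hξ.bdd_mul (hw.comp hDZ).aestronglyMeasurable hbound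
  have hzero : ∫ ω, (1 - D ω) / (1 - m0 (Z ω)) * (Y ω - g0 (D ω, Z ω)) ∂P = 0 :=
    integral_mul_eq_zero_of_condExp_eq_zero hDZ.comap_le
      (hw.comp (comap_measurable _)).stronglyMeasurable hint hξ hxi
  calc
    _ = ∫ ω, (g0 (0, Z ω) + (1 - D ω) / (1 - m0 (Z ω)) * (Y ω - g0 (D ω, Z ω))) ∂P := by
      refine integral_congr_ae ?_
      filter_upwards [hD01] with ω hd
      rcases hd with hd | hd <;> simp [hd] <;> ring
    _ = ∫ ω, g0 (0, Z ω) ∂P := by rw [integral_add hg0zint hint, hzero, add_zero]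
end

section
/- (Double robustness of ψ1, correctly specified outcome, i = 0) Under the noise condition E[ξ | σ(D,Z)] = 0 a.s. and D ∈ {0,1} a.s., for every measurable function m : E → ℝ satisfying ε ≤ m(Z) ≤ 1 − ε a.s. for some ε ∈ (0, 1/2), one has E[g0(0, Z) + (1 − D) · (Y − g0(0, Z)) / (1 − m(Z))] = E[g0(0, Z)] = θ0^0. -/
open MeasureTheory ProbabilityTheory

/-- A random variable with vanishing conditional expectation given `m` integrates to zero against
any `m`-measurable weight. -/
theorem integral_mul_eq_zero_of_condExp_eq_zero_s14 {Ω : Type*} {m m0 : MeasurableSpace Ω}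
    {μ : Measure Ω} [IsFiniteMeasure μ] (hm : m ≤ m0) {w ξ : Ω → ℝ}
    (hw : StronglyMeasurable[m] w) (hξ : Integrable ξ μ) (hwξ : Integrable (w * ξ) μ)
    (h : μ[ξ | m] =ᵐ[μ] 0) : ∫ ω, w ω * ξ ω ∂μ = 0 := by
  have hpull : μ[w * ξ | m] =ᵐ[μ] 0 := by
    filter_upwards [condExp_mul_of_stronglyMeasurable_left hw hwξ hξ, h] with ω h1 h2
    simp [h1, h2]
  calc ∫ ω, w ω * ξ ω ∂μ = ∫ ω, (μ[w * ξ | m]) ω ∂μ := (integral_condExp hm).symm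
    _ = 0 := by simp [integral_congr_ae hpull]

/-- Double robustness of ψ1, correctly specified outcome, i = 0: Under the noise
condition `E[ξ | σ(D,Z)] = 0` a.s. and `D ∈ {0,1}` a.s., for every measurable `m : E → ℝ` with
`ε ≤ m(Z) ≤ 1 − ε` a.s. for some `ε ∈ (0, 1/2)`,
`E[g0(0, Z) + (1 − D) · (Y − g0(0, Z)) / (1 − m(Z))] = E[g0(0, Z)] = θ0^0`. -/
theorem stmt_14
    {Ω : Type*} [MeasurableSpace Ω] (P : Measure Ω) [IsProbabilityMeasure P]
    {E : Type*} [MeasurableSpace E]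
    (Z : Ω → E) (hZ : Measurable Z)
    (D : Ω → ℝ) (hD : Measurable D) (hD01 : ∀ᵐ ω ∂P, D ω = 0 ∨ D ω = 1)
    (Y : Ω → ℝ) (hY : Integrable Y P)
    (g0 : ℝ × E → ℝ) (hg0 : Measurable g0)
    (hg0int : Integrable (fun ω => g0 (D ω, Z ω)) P)
    (hg0zint : Integrable (fun ω => g0 (0, Z ω)) P)
    (hxi : P[fun ω => Y ω - g0 (D ω, Z ω) |
        MeasurableSpace.comap (fun ω => (D ω, Z ω)) inferInstance] =ᵐ[P] 0) :
    ∀ m : E → ℝ, Measurable m →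
      ∀ ε : ℝ, ε ∈ Set.Ioo (0 : ℝ) (1 / 2) →
        (∀ᵐ ω ∂P, ε ≤ m (Z ω) ∧ m (Z ω) ≤ 1 - ε) →
        ∫ ω, (g0 (0, Z ω) + (1 - D ω) * (Y ω - g0 (0, Z ω)) / (1 - m (Z ω))) ∂P =
          ∫ ω, g0 (0, Z ω) ∂P := by
  intro m hm ε hε hmε
  have hDZ : Measurable fun ω => (D ω, Z ω) := hD.prodMk hZ
  let w : Ω → ℝ := fun ω => (1 - D ω) / (1 - m (Z ω))
  let ξ : Ω → ℝ := fun ω => Y ω - g0 (D ω, Z ω)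
  have hw : StronglyMeasurable[MeasurableSpace.comap (fun ω => (D ω, Z ω)) inferInstance] w := by
    have hφ : Measurable fun p : ℝ × E => (1 - p.1) / (1 - m p.2) := by fun_prop
    exact (hφ.comp (comap_measurable fun ω => (D ω, Z ω))).stronglyMeasurable
  have hξ : Integrable ξ P := hY.sub hg0int
  have hbound : ∀ᵐ ω ∂P, ‖w ω‖ ≤ 1 / ε := by
    filter_upwards [hD01, hmε] with ω hDω hmω
    have hpos : 0 < 1 - m (Z ω) := by linarith [hε.1]
    have hnum : |1 - D ω| ≤ 1 := by rcases hDω with h | h <;> simp [h]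
    rw [Real.norm_eq_abs, abs_div, abs_of_pos hpos]
    exact div_le_div₀ zero_le_one hnum hε.1 (by linarith)
  have hwξ : Integrable (w * ξ) P :=
    hξ.bdd_mul (hw.mono hDZ.comap_le).aestronglyMeasurable hbound
  have hcongr : (fun ω => g0 (0, Z ω) + (1 - D ω) * (Y ω - g0 (0, Z ω)) / (1 - m (Z ω)))
      =ᵐ[P] fun ω => g0 (0, Z ω) + (w * ξ) ω := by
    filter_upwards [hD01] with ω hDω
    rcases hDω with h | h <;> simp [w, ξ, h, div_eq_mul_inv, mul_comm]
  rw [integral_congr_ae hcongr, integral_add hg0zint hwξ]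
  simpa using integral_mul_eq_zero_of_condExp_eq_zero_s14 hDZ.comap_le hw hξ hwξ hxi
end

section
/- (IPW identification of the average treatment effect) Suppose D ∈ {0,1} a.s., Y = D·Y1 + (1 − D)·Y0 (consistency), the pair (Y0, Y1) is conditionally independent of D given σ(Z) (strong ignorability), and m0(Z) is a version of E[D | σ(Z)] with ε ≤ m0(Z) ≤ 1 − ε a.s. (overlap). If Y0 and Y1 are integrable, then the average treatment effect τ := E[Y1 − Y0] satisfies τ = E[D · Y / m0(Z) − (1 − D) · Y / (1 − m0(Z))]. -/
open MeasureTheory ProbabilityTheory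

theorem ProbabilityTheory.CondIndepFun.condExp_mul
    {Ω : Type*} {m mΩ : MeasurableSpace Ω} [StandardBorelSpace Ω] {hm : m ≤ mΩ}
    {μ : Measure Ω} [IsFiniteMeasure μ] {X T : Ω → ℝ}
    (h : CondIndepFun m hm X T μ) (hX : Integrable X μ) (hT : Integrable T μ)
    (hXT : Integrable (X * T) μ) :
    μ[X * T | m] =ᵐ[μ] μ[X | m] * μ[T | m] := by
  have ae_kernel {f : Ω → ℝ} (hf : Integrable f μ) :
      ∀ᵐ a ∂μ.trim hm, f =ᵐ[condExpKernel μ m a] hf.aemeasurable.mk f := by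
    refine Measure.ae_ae_of_ae_comp ?_
    rw [condExpKernel_comp_trim hm]
    exact hf.aemeasurable.ae_eq_mk
  have h' : CondIndepFun m hm (hX.aemeasurable.mk X) (hT.aemeasurable.mk T) μ :=
    Kernel.IndepFun.congr' h (ae_kernel hX) (ae_kernel hT)
  have hXm := hX.aemeasurable.measurable_mk
  have hTm := hT.aemeasurable.measurable_mk
  rw [condIndepFun_iff_map_prod_eq_prod_map_map hXm hTm] at h'
  filter_upwards [condExp_ae_eq_integral_condExpKernel hm hXT,
    condExp_ae_eq_integral_condExpKernel hm hX, condExp_ae_eq_integral_condExpKernel hm hT,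
    ae_of_ae_trim hm h', ae_of_ae_trim hm (ae_kernel hX), ae_of_ae_trim hm (ae_kernel hT)]
    with a hXTa hXa hTa hprod hXk hTk
  rw [Kernel.map_apply _ (hXm.prodMk hTm), Kernel.prod_apply, Kernel.map_apply _ hXm,
    Kernel.map_apply _ hTm, ← indepFun_iff_map_prod_eq_prod_map_map hXm.aemeasurable
      hTm.aemeasurable] at hprod
  rw [Pi.mul_apply, hXTa, hXa, hTa]
  exact (hprod.congr hXk.symm hTk.symm).integral_mul_eq_mul_integral
    (hXm.aestronglyMeasurable.congr hXk.symm) (hTm.aestronglyMeasurable.congr hTk.symm)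

/-- Inverse probability weighting: if `X` is independent of `T ∈ [-1, 1]` given `m` and `g`
is a version of `μ[T | m]` bounded away from zero, then `X * T / g` has the same mean as `X`. -/
theorem ProbabilityTheory.CondIndepFun.integral_mul_div_condExp
    {Ω : Type*} {m mΩ : MeasurableSpace Ω} [StandardBorelSpace Ω] {hm : m ≤ mΩ}
    {μ : Measure Ω} [IsFiniteMeasure μ] {X T g : Ω → ℝ} {ε : ℝ}
    (h : CondIndepFun m hm X T μ) (hX : Integrable X μ)
    (hT : AEStronglyMeasurable T μ) (hT1 : ∀ᵐ ω ∂μ, ‖T ω‖ ≤ 1)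
    (hg : StronglyMeasurable[m] g) (hgT : g =ᵐ[μ] μ[T | m])
    (hε : 0 < ε) (hεg : ∀ᵐ ω ∂μ, ε ≤ g ω) :
    Integrable (fun ω ↦ X ω * T ω / g ω) μ ∧ ∫ ω, X ω * T ω / g ω ∂μ = ∫ ω, X ω ∂μ := by
  have hTi : Integrable T μ := .of_bound hT 1 hT1
  have hXT : Integrable (X * T) μ := hX.mul_bdd (c := 1) hT hT1
  have hg' : StronglyMeasurable[m] g⁻¹ := hg.measurable.inv.stronglyMeasurable
  have hg1 : ∀ᵐ ω ∂μ, ‖g⁻¹ ω‖ ≤ ε⁻¹ := by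
    filter_upwards [hεg] with ω hω
    rw [Pi.inv_apply, norm_inv, Real.norm_of_nonneg (hε.le.trans hω)]
    exact inv_anti₀ hε hω
  have hint : Integrable (X * T * g⁻¹) μ :=
    hXT.mul_bdd (c := ε⁻¹) (hg'.mono hm).aestronglyMeasurable hg1
  have heq : (fun ω ↦ X ω * T ω / g ω) = X * T * g⁻¹ := by
    ext ω; simp [div_eq_mul_inv]
  refine ⟨heq ▸ hint, ?_⟩
  rw [heq, ← integral_condExp hm, ← integral_condExp hm (f := X)]
  refine integral_congr_ae ?_
  filter_upwards [condExp_mul_of_stronglyMeasurable_right hg' hint hXT,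
    h.condExp_mul hX hTi hXT, hgT, hεg] with ω h₁ h₂ h₃ h₄
  have : g ω ≠ 0 := (hε.trans_le h₄).ne'
  rw [h₁, Pi.mul_apply, h₂, Pi.mul_apply, ← h₃, Pi.inv_apply, mul_inv_cancel_right₀ this]

open MeasureTheory ProbabilityTheory

/-- IPW identification of the average treatment effect: Under consistency,
strong ignorability and overlap, the ATE `τ := E[Y1 − Y0]` satisfies
`τ = E[D · Y / m0(Z) − (1 − D) · Y / (1 − m0(Z))]`. -/
theorem stmt_17
    {Ω : Type*} [MeasurableSpace Ω] [StandardBorelSpace Ω] [Nonempty Ω]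
    (P : Measure Ω) [IsProbabilityMeasure P]
    {E : Type*} [MeasurableSpace E] [StandardBorelSpace E] [Nonempty E]
    (Z : Ω → E) (hZ : Measurable Z)
    (D : Ω → ℝ) (hD : Measurable D) (hD01 : ∀ᵐ ω ∂P, D ω = 0 ∨ D ω = 1)
    (Y0 Y1 : Ω → ℝ) (hY0 : Integrable Y0 P) (hY1 : Integrable Y1 P)
    (Y : Ω → ℝ) (hYdef : ∀ ω, Y ω = D ω * Y1 ω + (1 - D ω) * Y0 ω)
    (hindep : CondIndepFun (MeasurableSpace.comap Z inferInstance) hZ.comap_le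
      (fun ω => (Y0 ω, Y1 ω)) D P)
    (m0 : E → ℝ) (hm0 : Measurable m0)
    (hm0ver : (fun ω => m0 (Z ω)) =ᵐ[P] P[D | MeasurableSpace.comap Z inferInstance])
    (ε : ℝ) (hε : ε ∈ Set.Ioo (0 : ℝ) (1 / 2))
    (hover : ∀ᵐ ω ∂P, ε ≤ m0 (Z ω) ∧ m0 (Z ω) ≤ 1 - ε) :
    ∫ ω, (Y1 ω - Y0 ω) ∂P =
      ∫ ω, (D ω * Y ω / m0 (Z ω) - (1 - D ω) * Y ω / (1 - m0 (Z ω))) ∂P := by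
  have hm := hZ.comap_le
  have hDb : ∀ᵐ ω ∂P, ‖D ω‖ ≤ 1 := by
    filter_upwards [hD01] with ω hω
    rcases hω with h | h <;> simp [h]
  have hD'b : ∀ᵐ ω ∂P, ‖1 - D ω‖ ≤ 1 := by
    filter_upwards [hD01] with ω hω
    rcases hω with h | h <;> simp [h]
  have hDi : Integrable D P := .of_bound hD.aestronglyMeasurable 1 hDb
  have hg : Measurable[MeasurableSpace.comap Z inferInstance] (fun ω ↦ m0 (Z ω)) :=
    hm0.comp (comap_measurable Z)
  have hver' : (fun ω ↦ 1 - m0 (Z ω)) =ᵐ[P]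
      P[fun ω ↦ 1 - D ω | MeasurableSpace.comap Z inferInstance] := by
    filter_upwards [hm0ver, condExp_sub (integrable_const (1 : ℝ)) hDi
      (MeasurableSpace.comap Z inferInstance)] with ω h₁ h₂
    rw [h₁]
    refine Eq.trans ?_ h₂.symm
    rw [Pi.sub_apply, condExp_const hm]
  obtain ⟨hi₁, he₁⟩ := (hindep.comp measurable_snd measurable_id).integral_mul_div_condExp hY1
    hD.aestronglyMeasurable hDb hg.stronglyMeasurable hm0ver hε.1 (hover.mono fun _ h ↦ h.1)
  obtain ⟨hi₀, he₀⟩ := (hindep.comp measurable_fst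
      (measurable_const.sub measurable_id)).integral_mul_div_condExp hY0
    (hD.const_sub 1).aestronglyMeasurable hD'b (hg.const_sub 1).stronglyMeasurable hver' hε.1
    (hover.mono fun _ h ↦ by linarith [h.2])
  rw [integral_sub hY1 hY0]
  refine (congrArg₂ (· - ·) he₁ he₀).symm.trans ?_
  refine (integral_sub hi₁ hi₀).symm.trans (integral_congr_ae ?_)
  filter_upwards [hD01] with ω hω
  rcases hω with h | h <;> simp [h, hYdef]
end
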